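/- In the backward framework, the energy decays along backward light cones: lim_{T→0+} ∫_0^T [(1 − r/(2T − r))·u₋(2T − r, r)² + sin²u(2T − r, r)/r² + (u(2T − r, r) − sin u(2T − r, r)·cos u(2T − r, r))²/r⁴] r² dr = 0. -/

import Mathlib

open Real MeasureTheory Set Filter Topology

/-- Time derivative `u_t`. -/
noncomputable def ut (u : ℝ → ℝ → ℝ) (t r : ℝ) : ℝ := deriv (fun s => u s r) t

/-- Radial derivative `u_r`. -/
noncomputable def ur (u : ℝ → ℝ → ℝ) (t r : ℝ) : ℝ := deriv (fun s => u t s) r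

/-- Second time derivative `u_tt`. -/
noncomputable def utt (u : ℝ → ℝ → ℝ) (t r : ℝ) : ℝ := deriv (fun s => ut u s r) t

/-- Second radial derivative `u_rr`. -/
noncomputable def urr (u : ℝ → ℝ → ℝ) (t r : ℝ) : ℝ := deriv (fun s => ur u t s) r

/-- Null derivative `u₊ = u_t + u_r`. -/
noncomputable def uplus (u : ℝ → ℝ → ℝ) (t r : ℝ) : ℝ := ut u t r + ur u t r

/-- Null derivative `u₋ = u_t - u_r`. -/
noncomputable def uminus (u : ℝ → ℝ → ℝ) (t r : ℝ) : ℝ := ut u t r - ur u t r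

/-- The Adkins–Nappi equivariant wave equation at the point `(t, r)`. -/
def ANeq (u : ℝ → ℝ → ℝ) (t r : ℝ) : Prop :=
  utt u t r - urr u t r - (2 / r) * ur u t r + Real.sin (2 * u t r) / r ^ 2 +
      (u t r - Real.sin (u t r) * Real.cos (u t r)) * (1 - Real.cos (2 * u t r)) / r ^ 4 = 0

/-- The energy density `e(t,r)`. -/
noncomputable def eDens (u : ℝ → ℝ → ℝ) (t r : ℝ) : ℝ :=
  (1 / 2) * (ut u t r ^ 2 + ur u t r ^ 2) + Real.sin (u t r) ^ 2 / r ^ 2 +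
    (u t r - Real.sin (u t r) * Real.cos (u t r)) ^ 2 / (2 * r ^ 4)

/-- The backward domain `D(T̄)`. -/
def Dom (T : ℝ) : Set (ℝ × ℝ) :=
  {p : ℝ × ℝ | 0 < p.1 ∧ p.1 ≤ 2 * T ∧ 0 ≤ p.2 ∧ p.2 ≤ min (2 * T - p.1) p.1}

/-- The local energy `E(t) = ∫_0^t e(t,r) r² dr`. -/
noncomputable def locE (u : ℝ → ℝ → ℝ) (t : ℝ) : ℝ := ∫ r in (0 : ℝ)..t, eDens u t r * r ^ 2

/-- The flux `F(t₀, t₁)` through the light cone `t = r`. -/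
noncomputable def flux (u : ℝ → ℝ → ℝ) (t₀ t₁ : ℝ) : ℝ :=
  ∫ r in t₀..t₁,
    ((1 / 2) * uplus u r r ^ 2 + Real.sin (u r r) ^ 2 / r ^ 2 +
      (u r r - Real.sin (u r r) * Real.cos (u r r)) ^ 2 / (2 * r ^ 4)) * r ^ 2

/-- The backward framework: `u` is smooth on a neighborhood of `D(T̄)`, solves the
Adkins–Nappi equation on `D(T̄)` (for `r > 0`), and has finite energy `E(T̄)`. -/
def BackwardFramework (u : ℝ → ℝ → ℝ) (T : ℝ) : Prop :=
  0 < T ∧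
  (∃ V : Set (ℝ × ℝ), IsOpen V ∧ Dom T ⊆ V ∧
    ContDiffOn ℝ (⊤ : ℕ∞) (fun p : ℝ × ℝ => u p.1 p.2) V) ∧
  (∀ p ∈ Dom T, 0 < p.2 → ANeq u p.1 p.2) ∧
  IntegrableOn (fun r => eDens u T r * r ^ 2) (Set.Ioc 0 T)

/-- The point of the backward cone `t + r = 2b` with parameter `s`, running from `(b, b)` at `s = 0`
to the axis at `s = 1`. -/
def conePt (b s : ℝ) : ℝ × ℝ := (b * (1 + s), b * (1 - s))

/-- The integral of `N` over the backward cone `t + r = 2b`. -/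
noncomputable def coneInt (N : ℝ × ℝ → ℝ) (b : ℝ) : ℝ := ∫ s in (0 : ℝ)..1, b * N (conePt b s)

lemma continuous_conePt : Continuous fun q : ℝ × ℝ => conePt q.1 q.2 := by
  unfold conePt; fun_prop

lemma hasDerivAt_conePt_left (b s : ℝ) :
    HasDerivAt (fun b => conePt b s) ((1 + s, 1 - s) : ℝ × ℝ) b := by
  unfold conePt
  simpa using ((hasDerivAt_id b).mul_const (1 + s)).prodMk ((hasDerivAt_id b).mul_const (1 - s))

lemma hasDerivAt_conePt_right (b s : ℝ) :
    HasDerivAt (fun s => conePt b s) (b • ((1, -1) : ℝ × ℝ)) s := by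
  unfold conePt
  simpa using (((hasDerivAt_id s).const_add 1).const_mul b).prodMk
    (((hasDerivAt_id s).const_sub 1).const_mul b)

/-- Along the wedge swept by the backward cones, `ContinuousOn` functions restrict to continuous
functions on each cone. -/
lemma continuousOn_comp_conePt {W : Set (ℝ × ℝ)} {T : ℝ}
    (hwedge : ∀ b ∈ Ioo 0 T, ∀ s ∈ Icc (0 : ℝ) 1, conePt b s ∈ W) {f : ℝ × ℝ → ℝ}
    (hf : ContinuousOn f W) {b : ℝ} (hb : b ∈ Ioo 0 T) :
    ContinuousOn (fun s => f (conePt b s)) (Icc 0 1) :=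
  hf.comp (by unfold conePt; fun_prop) fun s hs => hwedge b hb s hs

lemma intervalIntegrable_comp_conePt {W : Set (ℝ × ℝ)} {T : ℝ}
    (hwedge : ∀ b ∈ Ioo 0 T, ∀ s ∈ Icc (0 : ℝ) 1, conePt b s ∈ W) {f : ℝ × ℝ → ℝ}
    (hf : ContinuousOn f W) {b : ℝ} (hb : b ∈ Ioo 0 T) :
    IntervalIntegrable (fun s => b * f (conePt b s)) volume 0 1 :=
  ContinuousOn.intervalIntegrable_of_Icc zero_le_one
    (continuousOn_const.mul (continuousOn_comp_conePt hwedge hf hb))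

lemma hasDerivAt_coneInt {W : Set (ℝ × ℝ)} {T : ℝ} (hW : IsOpen W)
    (hwedge : ∀ b ∈ Ioo 0 T, ∀ s ∈ Icc (0 : ℝ) 1, conePt b s ∈ W) {N M : ℝ × ℝ → ℝ}
    (hN : ContDiffOn ℝ 1 N W) (hM : ContDiffOn ℝ 1 M W)
    (hax : ∀ b ∈ Ioo 0 T, N (conePt b 1) = M (conePt b 1)) {b : ℝ} (hb : b ∈ Ioo 0 T) :
    HasDerivAt (coneInt N)
      (M (conePt b 0) + ∫ s in (0 : ℝ)..1, b * (fderiv ℝ N (conePt b s) (1, 1) +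
        fderiv ℝ M (conePt b s) (1, -1))) b := by
  have hdN := hN.continuousOn_fderiv_of_isOpen hW le_rfl
  have hdM := hM.continuousOn_fderiv_of_isOpen hW le_rfl
  have hNd : ∀ p ∈ W, HasFDerivAt N (fderiv ℝ N p) p := fun p hp =>
    ((hN.contDiffAt (hW.mem_nhds hp)).differentiableAt (by simp)).hasFDerivAt
  have hMd : ∀ p ∈ W, HasFDerivAt M (fderiv ℝ M p) p := fun p hp =>
    ((hM.contDiffAt (hW.mem_nhds hp)).differentiableAt (by simp)).hasFDerivAt
  set b₁ := b / 2 with hb₁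
  set b₂ := (b + T) / 2 with hb₂
  have h₁ : 0 < b₁ := by linarith [hb.1]
  have h₂ : b₂ < T := by linarith [hb.2]
  have hsub : Icc b₁ b₂ ⊆ Ioo 0 T := fun x hx => ⟨h₁.trans_le hx.1, hx.2.trans_lt h₂⟩
  set F' : ℝ → ℝ → ℝ := fun x s =>
    N (conePt x s) + x * fderiv ℝ N (conePt x s) (1 + s, 1 - s) with hF'
  have hcont : ContinuousOn (fun q : ℝ × ℝ => F' q.1 q.2) (Icc b₁ b₂ ×ˢ Icc 0 1) := by
    have hmaps : MapsTo (fun q : ℝ × ℝ => conePt q.1 q.2) (Icc b₁ b₂ ×ˢ Icc 0 1) W :=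
      fun q hq => hwedge _ (hsub hq.1) _ hq.2
    refine ContinuousOn.add (hN.continuousOn.comp continuous_conePt.continuousOn hmaps) ?_
    refine continuousOn_fst.mul ?_
    exact (hdN.comp continuous_conePt.continuousOn hmaps).clm_apply
      (Continuous.continuousOn (by fun_prop))
  obtain ⟨C, hC⟩ := (isCompact_Icc.prod isCompact_Icc).exists_bound_of_continuousOn hcont
  have hnhds : Icc b₁ b₂ ∈ 𝓝 b :=
    Icc_mem_nhds (by linarith [hb.1]) (by linarith [hb.2])
  have hderiv : ∀ x ∈ Icc b₁ b₂, ∀ s ∈ Icc (0 : ℝ) 1,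
      HasDerivAt (fun x => x * N (conePt x s)) (F' x s) x := by
    intro x hx s hs
    have := (hasDerivAt_id x).mul
      ((hNd _ (hwedge x (hsub hx) s hs)).comp_hasDerivAt x (hasDerivAt_conePt_left x s))
    exact this.congr_deriv (by simp [hF'])
  have hint := fun x (hx : x ∈ Icc b₁ b₂) =>
    intervalIntegrable_comp_conePt hwedge hN.continuousOn (hsub hx)
  have hbI : b ∈ Icc b₁ b₂ := mem_of_mem_nhds hnhds
  have hF'c : ContinuousOn (F' b) (Icc 0 1) :=
    hcont.comp (f := fun s : ℝ => (b, s)) (by fun_prop) fun s hs => ⟨hbI, hs⟩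
  have hF'i : IntervalIntegrable (F' b) volume 0 1 :=
    ContinuousOn.intervalIntegrable_of_Icc zero_le_one hF'c
  have huI : uIoc (0 : ℝ) 1 ⊆ Icc 0 1 := by
    rw [uIoc_of_le zero_le_one]; exact Ioc_subset_Icc_self
  have key := (intervalIntegral.hasDerivAt_integral_of_dominated_loc_of_deriv_le
    (F := fun x s => x * N (conePt x s)) (F' := F') (bound := fun _ => C) (a := 0) (b := 1)
    (μ := volume) hnhds
    (by filter_upwards [hnhds] with x hx using (hint x hx).aestronglyMeasurable_restrict_uIoc)
    (hint b hbI)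
    hF'i.aestronglyMeasurable_restrict_uIoc
    (Eventually.of_forall fun s hs x hx => hC (x, s) ⟨hx, huI hs⟩)
    (by simp)
    (Eventually.of_forall fun s hs x hx => hderiv x hx s (huI hs))).2
  have hSc : ContinuousOn (fun p => fderiv ℝ N p (1, 1) + fderiv ℝ M p (1, -1)) W :=
    (hdN.clm_apply continuousOn_const).add (hdM.clm_apply continuousOn_const)
  have hSi := intervalIntegrable_comp_conePt hwedge hSc hb
  have hprim : ∀ s ∈ uIcc (0 : ℝ) 1, HasDerivAt (fun s => s * N (conePt b s) - M (conePt b s))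
      (F' b s - b * (fderiv ℝ N (conePt b s) (1, 1) + fderiv ℝ M (conePt b s) (1, -1))) s := by
    intro s hs
    rw [uIcc_of_le zero_le_one] at hs
    have hp := hwedge b hb s hs
    have := ((hasDerivAt_id s).mul
      ((hNd _ hp).comp_hasDerivAt s (hasDerivAt_conePt_right b s))).sub
      ((hMd _ hp).comp_hasDerivAt s (hasDerivAt_conePt_right b s))
    refine this.congr_deriv ?_
    have e : ((1 + s, 1 - s) : ℝ × ℝ) = (1, 1) + s • ((1, -1) : ℝ × ℝ) := by
      ext <;> simp; ring
    simp only [hF', e, map_add, map_smul, smul_eq_mul, id, Function.comp_apply]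
    ring
  have hftc := intervalIntegral.integral_eq_sub_of_hasDerivAt hprim
    (hF'i.sub hSi)
  rw [intervalIntegral.integral_sub
    hF'i hSi, hax b hb] at hftc
  refine key.congr_deriv ?_
  linarith

/-- The nonlinearity `u - sin u cos u`. -/
noncomputable def anG (x : ℝ) : ℝ := x - sin x * cos x

lemma hasDerivAt_anG (x : ℝ) : HasDerivAt anG (2 * sin x ^ 2) x := by
  refine ((hasDerivAt_id x).sub ((hasDerivAt_sin x).mul (hasDerivAt_cos x))).congr_deriv ?_
  nlinarith [sin_sq_add_cos_sq x]

lemma anG_zero : anG 0 = 0 := by simp [anG]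

lemma contDiff_anG : ContDiff ℝ 1 anG := by
  unfold anG; fun_prop

lemma abs_anG_le (x : ℝ) : |anG x| ≤ 2 * |x| ^ 3 := by
  have h := (convex_Icc (-|x|) |x|).norm_image_sub_le_of_norm_deriv_le (f := anG) (x := 0) (y := x)
    (C := 2 * |x| ^ 2) (fun y _ => (hasDerivAt_anG y).differentiableAt) ?_ ?_ ?_
  · simpa [anG_zero, pow_succ, mul_assoc] using h
  · intro y hy
    rw [(hasDerivAt_anG y).deriv, norm_eq_abs, abs_of_nonneg (by positivity), ← sq_abs (sin y)]
    have h1 := abs_sin_le_abs (x := y)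
    have h2 := abs_le.2 hy
    exact mul_le_mul_of_nonneg_left (pow_le_pow_left₀ (abs_nonneg _) (h1.trans h2) 2) zero_le_two
  · simp
  · exact ⟨neg_abs_le x, le_abs_self x⟩

lemma eq_zero_of_anG_eq_zero {x : ℝ} (h : anG x = 0) : x = 0 := by
  by_contra hx
  have h1 : |sin (2 * x)| < |2 * x| := abs_sin_lt_abs (by simpa using hx)
  have h2 : sin (2 * x) = 2 * x := by
    rw [sin_two_mul]; unfold anG at h; linarith
  rw [h2] at h1
  exact lt_irrefl _ h1

lemma mul_anG_nonneg (x : ℝ) : 0 ≤ x * anG x := by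
  have hm : Monotone anG := monotone_of_deriv_nonneg
    (fun y => (hasDerivAt_anG y).differentiableAt) fun y => by
      rw [(hasDerivAt_anG y).deriv]; positivity
  rcases le_total 0 x with h | h
  · exact mul_nonneg h (anG_zero ▸ hm h)
  · exact mul_nonneg_of_nonpos_of_nonpos h (anG_zero ▸ hm h)

/-- A `C¹` function vanishing on the axis `r = 0` gives a `C¹` singular potential
`(u - sin u cos u)² / (2 r²)`. -/
lemma contDiffOn_singularPotential {W : Set (ℝ × ℝ)} (hW : IsOpen W) {U : ℝ × ℝ → ℝ}
    (hU : ContDiffOn ℝ 1 U W) (hax : ∀ p ∈ W, p.2 = 0 → U p = 0) :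
    ContDiffOn ℝ 1 (fun p : ℝ × ℝ => anG (U p) ^ 2 / (2 * p.2 ^ 2)) W := by
  intro p₀ hp₀
  have hUat := hU.contDiffAt (hW.mem_nhds hp₀)
  by_cases h₀ : p₀.2 = 0
  swap
  · refine (ContDiffAt.div ?_ (by fun_prop) (by positivity)).contDiffWithinAt
    exact ((contDiff_anG.contDiffAt).comp p₀ hUat).pow 2
  have hdU := hU.continuousOn_fderiv_of_isOpen hW le_rfl
  obtain ⟨L, s, hs, hL⟩ := hUat.exists_lipschitzOnWith
  have hproj : Tendsto (fun p : ℝ × ℝ => ((p.1, 0) : ℝ × ℝ)) (𝓝 p₀) (𝓝 p₀) := by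
    have : Continuous fun p : ℝ × ℝ => ((p.1, 0) : ℝ × ℝ) := by fun_prop
    have h := this.tendsto p₀
    rwa [show ((p₀.1, 0) : ℝ × ℝ) = p₀ from Prod.ext rfl h₀.symm] at h
  have hbd : ∀ᶠ p in 𝓝 p₀, |U p| ≤ L * |p.2| := by
    filter_upwards [hs, hproj hs, hproj (hW.mem_nhds hp₀)] with p h1 h2 h3
    have := hL.norm_sub_le h1 h2
    rw [hax _ h3 rfl, sub_zero] at this
    simpa [Prod.norm_def] using this
  set D : ℝ × ℝ → (ℝ × ℝ →L[ℝ] ℝ) := fun p =>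
    (2 * anG (U p) * sin (U p) ^ 2 / p.2 ^ 2) • fderiv ℝ U p -
      (anG (U p) ^ 2 / p.2 ^ 3) • ContinuousLinearMap.snd ℝ ℝ ℝ with hD
  obtain ⟨ε, hε, hball⟩ := Metric.eventually_nhds_iff_ball.1
    (hbd.and (hW.mem_nhds hp₀))
  have hG : ∀ p ∈ Metric.ball p₀ ε, |anG (U p)| ≤ 2 * (L * |p.2|) ^ 3 := fun p hp =>
    (abs_anG_le _).trans (by gcongr; exact (hball p hp).1)
  have hDoff : ∀ p ∈ W, p.2 ≠ 0 →
      HasFDerivAt (fun p : ℝ × ℝ => anG (U p) ^ 2 / (2 * p.2 ^ 2)) (D p) p := by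
    intro p hp h
    have hUp := ((hU.contDiffAt (hW.mem_nhds hp)).differentiableAt (by simp)).hasFDerivAt
    have h1 := ((hasDerivAt_anG (U p)).comp_hasFDerivAt p hUp).pow 2
    have h2 := ((hasFDerivAt_snd (𝕜 := ℝ) (p := p)).pow 2).const_mul 2
    have h3 := h1.mul ((hasDerivAt_inv (x := 2 * p.2 ^ 2) (by positivity)).comp_hasFDerivAt p h2)
    refine (h3.congr_fderiv ?_).congr_of_eventuallyEq
      (Eventually.of_forall fun q => div_eq_mul_inv _ _)
    ext
    · simp [hD]; field_simp
    · simp [hD]; field_simp; ring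
  have hDon : ∀ p ∈ Metric.ball p₀ ε, p.2 = 0 → D p = 0 := by
    intro p hp h
    simp [hD, h]
  refine (contDiffAt_one_iff.2 ⟨D, Metric.ball p₀ ε, Metric.ball_mem_nhds _ hε, ?_, ?_⟩
    ).contDiffWithinAt
  · intro p hp
    have hpW := (hball p hp).2
    by_cases h : p.2 = 0
    · refine ContinuousAt.continuousWithinAt ?_
      have c2 : ContinuousAt (fderiv ℝ U) p := hdU.continuousAt (hW.mem_nhds hpW)
      have hF : ∀ᶠ q in 𝓝 p, ‖fderiv ℝ U q‖ ≤ ‖fderiv ℝ U p‖ + 1 :=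
        (c2.norm.eventually_lt_const (lt_add_one _)).mono fun q hq => hq.le
      rw [ContinuousAt, hDon p hp h]
      refine squeeze_zero_norm' (a := fun q : ℝ × ℝ =>
        4 * L ^ 3 * |q.2| * (‖fderiv ℝ U p‖ + 1) + 4 * L ^ 6 * |q.2| ^ 3) ?_ ?_
      · filter_upwards [hF, Metric.isOpen_ball.mem_nhds hp] with q hq hqb
        by_cases hq0 : q.2 = 0
        · rw [hDon q hqb hq0, norm_zero]; positivity
        have hq0' : 0 < |q.2| := abs_pos.2 hq0
        have hGq := hG q hqb
        refine (norm_sub_le _ _).trans (add_le_add ?_ ?_)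
        · rw [norm_smul]
          refine mul_le_mul ?_ hq (norm_nonneg _) (by positivity)
          rw [norm_div, norm_mul, norm_mul, norm_pow, norm_pow]
          simp only [norm_eq_abs, abs_two]
          rw [div_le_iff₀ (by positivity)]
          have h1 : |sin (U q)| ^ 2 ≤ 1 := pow_le_one₀ (abs_nonneg _) (abs_sin_le_one _)
          calc 2 * |anG (U q)| * |sin (U q)| ^ 2 ≤ 2 * (2 * (L * |q.2|) ^ 3) * 1 := by gcongr
            _ = 4 * L ^ 3 * |q.2| * |q.2| ^ 2 := by ring
        · rw [norm_smul]
          have h1 : ‖ContinuousLinearMap.snd ℝ ℝ ℝ‖ ≤ 1 := ContinuousLinearMap.norm_snd_le _ _ _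
          refine (mul_le_of_le_one_right (norm_nonneg _) h1).trans ?_
          rw [norm_div, norm_pow, norm_pow]
          simp only [norm_eq_abs]
          rw [div_le_iff₀ (by positivity)]
          calc |anG (U q)| ^ 2 ≤ (2 * (L * |q.2|) ^ 3) ^ 2 := by gcongr
            _ = 4 * L ^ 6 * |q.2| ^ 3 * |q.2| ^ 3 := by ring
      · have : Continuous fun q : ℝ × ℝ =>
            4 * (L : ℝ) ^ 3 * |q.2| * (‖fderiv ℝ U p‖ + 1) + 4 * (L : ℝ) ^ 6 * |q.2| ^ 3 := by
          fun_prop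
        simpa [h] using this.tendsto p
    · refine ContinuousAt.continuousWithinAt ?_
      have c1 : ContinuousAt U p := hU.continuousOn.continuousAt (hW.mem_nhds hpW)
      have c2 : ContinuousAt (fderiv ℝ U) p := hdU.continuousAt (hW.mem_nhds hpW)
      have c3 : ContinuousAt (fun p => anG (U p)) p :=
        (hasDerivAt_anG _).continuousAt.comp c1
      have c4 : ContinuousAt (fun p => sin (U p)) p := continuous_sin.continuousAt.comp c1
      refine ContinuousAt.fun_sub (ContinuousAt.fun_smul ?_ c2)
        (ContinuousAt.fun_smul ?_ continuousAt_const)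
      · exact ((c3.const_mul 2).mul (c4.pow 2)).div (by fun_prop) (by positivity)
      · exact (c3.pow 2).div (by fun_prop) (by positivity)
  · intro p hp
    by_cases h : p.2 = 0
    · rw [hDon p hp h]
      refine Asymptotics.IsBigO.hasFDerivAt (n := 4) ?_ (by norm_num)
      refine Asymptotics.IsBigO.of_bound (2 * L ^ 6) ?_
      filter_upwards [Metric.isOpen_ball.mem_nhds hp] with q hqb
      have hGq := hG q hqb
      have h1 : |q.2| ≤ ‖q - p‖ := by
        simpa [h] using norm_snd_le (q - p)
      rw [norm_div, norm_mul, norm_pow, norm_pow, norm_pow, norm_norm]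
      simp only [norm_eq_abs, abs_two]
      calc |anG (U q)| ^ 2 / (2 * |q.2| ^ 2) ≤ (2 * (L * |q.2|) ^ 3) ^ 2 / (2 * |q.2| ^ 2) := by
            gcongr
        _ = 2 * L ^ 6 * |q.2| ^ 4 := by
            by_cases hq0 : q.2 = 0
            · simp [hq0]
            · have : |q.2| ≠ 0 := abs_ne_zero.2 hq0
              field_simp
        _ ≤ 2 * L ^ 6 * ‖q - p‖ ^ 4 := by gcongr
    · exact hDoff p (hball p hp).2 h

/-- Time derivative as a Fréchet derivative. -/
noncomputable def dT (U : ℝ × ℝ → ℝ) (p : ℝ × ℝ) : ℝ := fderiv ℝ U p (1, 0)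

/-- Radial derivative as a Fréchet derivative. -/
noncomputable def dR (U : ℝ × ℝ → ℝ) (p : ℝ × ℝ) : ℝ := fderiv ℝ U p (0, 1)

/-- A smooth solution of the Adkins–Nappi equation, vanishing on the axis, on the wedge swept by the
backward cones `t + r = 2b` with `0 < b < T`. -/
structure ConeSolution (U : ℝ × ℝ → ℝ) (W : Set (ℝ × ℝ)) (T : ℝ) : Prop where
  pos : 0 < T
  isOpen : IsOpen W
  time_pos : ∀ p ∈ W, 0 < p.1
  wedge : ∀ b ∈ Ioo 0 T, ∀ s ∈ Icc (0 : ℝ) 1, conePt b s ∈ W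
  contDiffOn : ContDiffOn ℝ 2 U W
  axis : ∀ p ∈ W, p.2 = 0 → U p = 0
  eqn : ∀ b ∈ Ioo 0 T, ∀ s ∈ Ico (0 : ℝ) 1, ∀ p, p = conePt b s →
    dT (dT U) p - dR (dR U) p - 2 / p.2 * dR U p + sin (2 * U p) / p.2 ^ 2 +
      anG (U p) * (2 * sin (U p) ^ 2) / p.2 ^ 4 = 0

/-- Energy flux density through the null hypersurfaces with tangent `(1, σ)`, `σ = ±1`. -/
noncomputable def enDens (U : ℝ × ℝ → ℝ) (σ : ℝ) (p : ℝ × ℝ) : ℝ :=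
  1 / 2 * p.2 ^ 2 * (dT U p + σ * dR U p) ^ 2 + sin (U p) ^ 2 + anG (U p) ^ 2 / (2 * p.2 ^ 2)

/-- Flux density of the scaling multiplier `t ∂ₜ + r ∂ᵣ + 1`. -/
noncomputable def scDens (U : ℝ × ℝ → ℝ) (σ : ℝ) (p : ℝ × ℝ) : ℝ :=
  (p.1 + σ * p.2) / 2 * (p.2 ^ 2 * (dT U p + σ * dR U p) ^ 2) +
    (p.1 - σ * p.2) * (sin (U p) ^ 2 + anG (U p) ^ 2 / (2 * p.2 ^ 2)) +
    p.2 ^ 2 * U p * (dT U p + σ * dR U p)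

lemma enDens_nonneg (U : ℝ × ℝ → ℝ) (σ : ℝ) (p : ℝ × ℝ) : 0 ≤ enDens U σ p := by
  unfold enDens; positivity

lemma contDiffOn_dT_of_isOpen {U : ℝ × ℝ → ℝ} {V : Set (ℝ × ℝ)} (hV : IsOpen V)
    (hU : ContDiffOn ℝ 2 U V) :
    ContDiffOn ℝ 1 (dT U) V :=
  (hU.fderiv_of_isOpen hV (by norm_num)).clm_apply contDiffOn_const

lemma contDiffOn_dR_of_isOpen {U : ℝ × ℝ → ℝ} {V : Set (ℝ × ℝ)} (hV : IsOpen V)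
    (hU : ContDiffOn ℝ 2 U V) :
    ContDiffOn ℝ 1 (dR U) V :=
  (hU.fderiv_of_isOpen hV (by norm_num)).clm_apply contDiffOn_const

namespace ConeSolution

variable {U : ℝ × ℝ → ℝ} {W : Set (ℝ × ℝ)} {T : ℝ}

lemma contDiffOn_dT (h : ConeSolution U W T) : ContDiffOn ℝ 1 (dT U) W :=
  contDiffOn_dT_of_isOpen h.isOpen h.contDiffOn

lemma contDiffOn_dR (h : ConeSolution U W T) : ContDiffOn ℝ 1 (dR U) W :=
  contDiffOn_dR_of_isOpen h.isOpen h.contDiffOn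

lemma contDiffOn_enDens (h : ConeSolution U W T) (σ : ℝ) : ContDiffOn ℝ 1 (enDens U σ) W := by
  have h1 := h.contDiffOn_dT
  have h2 := h.contDiffOn_dR
  have h3 : ContDiffOn ℝ 1 U W := h.contDiffOn.of_le (by norm_num)
  have h4 := contDiffOn_singularPotential h.isOpen h3 h.axis
  unfold enDens
  fun_prop

lemma contDiffOn_scDens (h : ConeSolution U W T) (σ : ℝ) : ContDiffOn ℝ 1 (scDens U σ) W := by
  have h1 := h.contDiffOn_dT
  have h2 := h.contDiffOn_dR
  have h3 : ContDiffOn ℝ 1 U W := h.contDiffOn.of_le (by norm_num)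
  have h4 := contDiffOn_singularPotential h.isOpen h3 h.axis
  unfold scDens
  fun_prop

lemma dT_dR_comm (h : ConeSolution U W T) {p : ℝ × ℝ} (hp : p ∈ W) :
    dT (dR U) p = dR (dT U) p := by
  have hat := h.contDiffOn.contDiffAt (h.isOpen.mem_nhds hp)
  have hs := hat.isSymmSndFDerivAt (by simp)
  have hd : DifferentiableAt ℝ (fderiv ℝ U) p :=
    (hat.fderiv_right (m := 1) (by norm_num)).differentiableAt (by simp)
  have e (v w : ℝ × ℝ) : fderiv ℝ (fun q => fderiv ℝ U q v) p w = fderiv ℝ (fderiv ℝ U) p w v := by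
    rw [fderiv_clm_apply hd (differentiableAt_const v)]
    simp
  unfold dT dR
  rw [e, e]
  exact hs _ _

lemma fderiv_apply_eq {f : ℝ × ℝ → ℝ} (p v : ℝ × ℝ) :
    fderiv ℝ f p v = v.1 * dT f p + v.2 * dR f p := by
  have : v = v.1 • ((1, 0) : ℝ × ℝ) + v.2 • ((0, 1) : ℝ × ℝ) := by ext <;> simp
  conv_lhs => rw [this, map_add, map_smul, map_smul]
  rfl

lemma hasDerivAt_line {f : ℝ × ℝ → ℝ} (hW : IsOpen W) (hf : ContDiffOn ℝ 1 f W) {p : ℝ × ℝ}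
    (hp : p ∈ W) (v : ℝ × ℝ) :
    HasDerivAt (fun τ : ℝ => f (p + τ • v)) (fderiv ℝ f p v) 0 := by
  have h1 := ((hf.contDiffAt (hW.mem_nhds hp)).differentiableAt (by simp)).hasFDerivAt
  have h2 : HasDerivAt (fun τ : ℝ => p + τ • v) v 0 := by
    simpa using ((hasDerivAt_id (0 : ℝ)).smul_const v).const_add p
  have h1' : HasFDerivAt f (fderiv ℝ f p) (p + (0 : ℝ) • v) := by simpa using h1
  exact h1'.comp_hasDerivAt 0 h2

lemma fderiv_enDens (h : ConeSolution U W T) {p : ℝ × ℝ} (hp : p ∈ W) (hr : p.2 ≠ 0) {σ : ℝ}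
    (hσ : σ ^ 2 = 1) :
    fderiv ℝ (enDens U σ) p (1, -σ) =
      -σ * p.2 * (dT U p + σ * dR U p) ^ 2 +
      p.2 ^ 2 * (dT U p + σ * dR U p) * (dT (dT U) p - dR (dR U) p) +
      (sin (2 * U p) + anG (U p) * (2 * sin (U p) ^ 2) / p.2 ^ 2) * (dT U p - σ * dR U p) +
      σ * (anG (U p) ^ 2 / p.2 ^ 3) := by
  have hU := hasDerivAt_line h.isOpen (h.contDiffOn.of_le (by norm_num)) hp (1, -σ)
  have hX := hasDerivAt_line h.isOpen h.contDiffOn_dT hp (1, -σ)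
  have hY := hasDerivAt_line h.isOpen h.contDiffOn_dR hp (1, -σ)
  have hR : HasDerivAt (fun τ : ℝ => (p + τ • ((1, -σ) : ℝ × ℝ)).2) (-σ) 0 := by
    simpa using ((hasDerivAt_id (0 : ℝ)).mul_const (-σ)).const_add p.2
  have hG := (hasDerivAt_anG _).comp (0 : ℝ) hU
  have hr0 : 2 * (p + (0 : ℝ) • ((1, -σ) : ℝ × ℝ)).2 ^ 2 ≠ 0 := by simpa using hr
  have key := ((((hR.pow 2).const_mul (1 / 2)).mul ((hX.add (hY.const_mul σ)).pow 2)).add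
    (hU.sin.pow 2)).add ((hG.pow 2).div ((hR.pow 2).const_mul 2) hr0)
  have h1 := (hasDerivAt_line h.isOpen (h.contDiffOn_enDens σ) hp (1, -σ)).unique key
  rw [h1]
  simp only [fderiv_apply_eq, zero_smul, add_zero, Function.comp_apply, h.dT_dR_comm hp,
    sin_two_mul, Pi.add_apply, Pi.pow_apply]
  field_simp
  linear_combination (-(2 * p.2 ^ 6 * (dT U p + σ * dR U p) * dR (dR U) p)) * hσ

lemma fderiv_scDens (h : ConeSolution U W T) {p : ℝ × ℝ} (hp : p ∈ W) {σ : ℝ} (hσ : σ ^ 2 = 1) :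
    fderiv ℝ (scDens U σ) p (1, -σ) =
      2 * enDens U σ p + (p.1 - σ * p.2) * fderiv ℝ (enDens U σ) p (1, -σ) +
      (-3 * p.2 ^ 2 * (dT U p + σ * dR U p) ^ 2 +
        2 * σ * p.2 ^ 3 * (dT U p + σ * dR U p) * (dT (dT U) p - dR (dR U) p)) -
      2 * σ * p.2 * U p * (dT U p + σ * dR U p) +
      p.2 ^ 2 * (dT U p - σ * dR U p) * (dT U p + σ * dR U p) +
      p.2 ^ 2 * U p * (dT (dT U) p - dR (dR U) p) := by
  have hU := hasDerivAt_line h.isOpen (h.contDiffOn.of_le (by norm_num)) hp (1, -σ)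
  have hX := hasDerivAt_line h.isOpen h.contDiffOn_dT hp (1, -σ)
  have hY := hasDerivAt_line h.isOpen h.contDiffOn_dR hp (1, -σ)
  have hE := hasDerivAt_line h.isOpen (h.contDiffOn_enDens σ) hp (1, -σ)
  have hT : HasDerivAt (fun τ : ℝ => (p + τ • ((1, -σ) : ℝ × ℝ)).1) 1 0 := by
    simpa using (hasDerivAt_id (0 : ℝ)).const_add p.1
  have hR : HasDerivAt (fun τ : ℝ => (p + τ • ((1, -σ) : ℝ × ℝ)).2) (-σ) 0 := by
    simpa using ((hasDerivAt_id (0 : ℝ)).mul_const (-σ)).const_add p.2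
  have hS := hX.add (hY.const_mul σ)
  have key := (((hT.sub (hR.const_mul σ)).mul hE).add
    (((hR.pow 3).const_mul σ).mul (hS.pow 2))).add (((hR.pow 2).mul hU).mul hS)
  have hrw : scDens U σ = fun p => (p.1 - σ * p.2) * enDens U σ p +
      σ * p.2 ^ 3 * (dT U p + σ * dR U p) ^ 2 + p.2 ^ 2 * U p * (dT U p + σ * dR U p) := by
    funext q
    unfold scDens enDens
    ring
  have h1 := (hasDerivAt_line h.isOpen (h.contDiffOn_scDens σ) hp (1, -σ)).unique
    (key.congr_of_eventuallyEq (Eventually.of_forall fun τ => by rw [hrw]; rfl))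
  rw [h1]
  simp only [fderiv_apply_eq _ (1, -σ), zero_smul, add_zero, h.dT_dR_comm hp,
    Pi.add_apply, Pi.pow_apply, Pi.mul_apply, Pi.sub_apply]
  push_cast
  linear_combination (enDens U σ p - 3 * p.2 ^ 2 * (dT U p + σ * dR U p) ^ 2
    - (p.2 ^ 2 * U p * dR (dR U) p) - (2 * σ * p.2 ^ 3 * (dT U p + σ * dR U p) * dR (dR U) p)) * hσ

lemma fderiv_enDens_add (h : ConeSolution U W T) {b s : ℝ} (hb : b ∈ Ioo 0 T)
    (hs : s ∈ Ico (0 : ℝ) 1) :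
    fderiv ℝ (enDens U (-1)) (conePt b s) (1, 1) +
      fderiv ℝ (enDens U 1) (conePt b s) (1, -1) = 0 := by
  have hp := h.wedge b hb s ⟨hs.1, hs.2.le⟩
  have hr : (conePt b s).2 ≠ 0 := (mul_pos hb.1 (by linarith [hs.2])).ne'
  have he := h.eqn b hb s hs _ rfl
  have h1 := h.fderiv_enDens hp hr (σ := -1) (by norm_num)
  have h2 := h.fderiv_enDens hp hr (σ := 1) (by norm_num)
  rw [neg_neg] at h1
  rw [h1, h2]
  generalize conePt b s = p at *
  field_simp at he ⊢
  linear_combination 2 * p.2 * dT U p * he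

lemma fderiv_scDens_add (h : ConeSolution U W T) {b s : ℝ} (hb : b ∈ Ioo 0 T)
    (hs : s ∈ Ico (0 : ℝ) 1) :
    fderiv ℝ (scDens U (-1)) (conePt b s) (1, 1) + fderiv ℝ (scDens U 1) (conePt b s) (1, -1) =
      4 * sin (U (conePt b s)) ^ 2 - 2 * U (conePt b s) * (sin (2 * U (conePt b s)) +
        anG (U (conePt b s)) * (2 * sin (U (conePt b s)) ^ 2) / (conePt b s).2 ^ 2) := by
  have hp := h.wedge b hb s ⟨hs.1, hs.2.le⟩
  have hr : (conePt b s).2 ≠ 0 := (mul_pos hb.1 (by linarith [hs.2])).ne'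
  have he := h.eqn b hb s hs _ rfl
  have h1 := h.fderiv_scDens hp (σ := -1) (by norm_num)
  have h2 := h.fderiv_scDens hp (σ := 1) (by norm_num)
  have h3 := h.fderiv_enDens hp hr (σ := -1) (by norm_num)
  have h4 := h.fderiv_enDens hp hr (σ := 1) (by norm_num)
  rw [neg_neg] at h1 h3
  rw [h1, h2, h3, h4]
  unfold enDens
  generalize conePt b s = p at *
  field_simp at he ⊢
  linear_combination (2 * p.1 * dT U p + 2 * p.2 * dR U p + 2 * U p) * p.2 * he

lemma hasDerivAt_energy (h : ConeSolution U W T) {b : ℝ} (hb : b ∈ Ioo 0 T) :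
    HasDerivAt (coneInt (enDens U (-1))) (enDens U 1 (conePt b 0)) b := by
  refine (hasDerivAt_coneInt h.isOpen h.wedge (h.contDiffOn_enDens _) (h.contDiffOn_enDens 1)
    (fun b _ => by simp [enDens, conePt]) hb).congr_deriv ?_
  rw [add_eq_left]
  refine (intervalIntegral.integral_congr_ae (g := fun _ => 0) ?_).trans (by simp)
  filter_upwards [volume.ae_ne (1 : ℝ)] with s hs1 hs
  rw [uIoc_of_le zero_le_one] at hs
  rw [h.fderiv_enDens_add hb ⟨hs.1.le, lt_of_le_of_ne hs.2 hs1⟩, mul_zero]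

lemma monotoneOn_energy (h : ConeSolution U W T) :
    MonotoneOn (coneInt (enDens U (-1))) (Ioo 0 T) := by
  refine monotoneOn_of_deriv_nonneg (convex_Ioo 0 T)
    (fun b hb => (h.hasDerivAt_energy hb).continuousAt.continuousWithinAt)
    (fun b hb => ?_) (fun b hb => ?_) <;> rw [interior_Ioo] at hb
  · exact (h.hasDerivAt_energy hb).differentiableAt.differentiableWithinAt
  · rw [(h.hasDerivAt_energy hb).deriv]
    exact enDens_nonneg _ _ _

lemma intervalIntegrable_enDens (h : ConeSolution U W T) {b : ℝ} (hb : b ∈ Ioo 0 T) :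
    IntervalIntegrable (fun s => b * enDens U (-1) (conePt b s)) volume 0 1 :=
  intervalIntegrable_comp_conePt h.wedge (h.contDiffOn_enDens _).continuousOn hb

lemma neg_anG_mul_le (h : ConeSolution U W T) {p : ℝ × ℝ} (hp : p ∈ W) :
    -(anG (U p) * (dT U p - dR U p)) ≤ enDens U (-1) p := by
  by_cases hr : p.2 = 0
  · rw [h.axis p hp hr, anG_zero, zero_mul, neg_zero]
    exact enDens_nonneg _ _ _
  have key : enDens U (-1) p + anG (U p) * (dT U p - dR U p) =
      1 / 2 * (p.2 * (dT U p - dR U p) + anG (U p) / p.2) ^ 2 + sin (U p) ^ 2 := by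
    unfold enDens
    field_simp
    ring
  have : 0 ≤ 1 / 2 * (p.2 * (dT U p - dR U p) + anG (U p) / p.2) ^ 2 + sin (U p) ^ 2 := by
    positivity
  linarith

/-- The energy controls the solution pointwise. -/
lemma sq_le_energy (h : ConeSolution U W T) {b s : ℝ} (hb : b ∈ Ioo 0 T) (hs : s ∈ Icc (0 : ℝ) 1) :
    U (conePt b s) ^ 2 ≤ 2 * coneInt (enDens U (-1)) b + 1 := by
  have hU1 : ContDiffOn ℝ 1 U W := h.contDiffOn.of_le (by norm_num)
  set f : ℝ → ℝ := fun x => b * (anG (U (conePt b x)) * (dT U (conePt b x) - dR U (conePt b x)))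
    with hf
  have hfc : ContinuousOn f (Icc 0 1) := by
    refine continuousOn_const.mul (ContinuousOn.mul ?_ (ContinuousOn.sub ?_ ?_))
    · exact contDiff_anG.continuous.comp_continuousOn
        (continuousOn_comp_conePt h.wedge hU1.continuousOn hb)
    · exact continuousOn_comp_conePt h.wedge h.contDiffOn_dT.continuousOn hb
    · exact continuousOn_comp_conePt h.wedge h.contDiffOn_dR.continuousOn hb
  have hsub : Icc s 1 ⊆ Icc 0 1 := Icc_subset_Icc_left hs.1
  have hfi : IntervalIntegrable f volume s 1 :=
    ContinuousOn.intervalIntegrable_of_Icc hs.2 (hfc.mono hsub)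
  have hderiv : ∀ x ∈ uIcc s 1, HasDerivAt
      (fun x => U (conePt b x) ^ 2 / 2 - sin (U (conePt b x)) ^ 2 / 2) (f x) x := by
    intro x hx
    rw [uIcc_of_le hs.2] at hx
    have hp := h.wedge b hb x (hsub hx)
    have hUd := ((hU1.contDiffAt (h.isOpen.mem_nhds hp)).differentiableAt
      (by simp)).hasFDerivAt.comp_hasDerivAt x (hasDerivAt_conePt_right b x)
    refine (((hUd.pow 2).div_const 2).sub ((hUd.sin.pow 2).div_const 2)).congr_deriv ?_
    rw [map_smul, fderiv_apply_eq]
    simp only [hf, anG, Function.comp_apply, smul_eq_mul]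
    push_cast
    ring
  have hftc := intervalIntegral.integral_eq_sub_of_hasDerivAt hderiv hfi
  have hend : U (conePt b 1) = 0 :=
    h.axis _ (h.wedge b hb 1 ⟨zero_le_one, le_rfl⟩) (by simp [conePt])
  have hei := h.intervalIntegrable_enDens hb
  have hei' : IntervalIntegrable (fun s => b * enDens U (-1) (conePt b s)) volume s 1 :=
    hei.mono_set (by rw [uIcc_of_le hs.2, uIcc_of_le zero_le_one]; exact hsub)
  have h1 : ∫ x in s..1, -f x ≤ ∫ x in s..1, b * enDens U (-1) (conePt b x) := by
    refine intervalIntegral.integral_mono_on hs.2 hfi.neg hei' fun x hx => ?_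
    have := mul_le_mul_of_nonneg_left (h.neg_anG_mul_le (h.wedge b hb x (hsub hx))) hb.1.le
    simp only [hf]
    linarith
  have h2 : ∫ x in s..1, b * enDens U (-1) (conePt b x) ≤ coneInt (enDens U (-1)) b := by
    refine intervalIntegral.integral_mono_interval hs.1 hs.2 le_rfl
      (Eventually.of_forall fun x => mul_nonneg hb.1.le (enDens_nonneg _ _ _)) hei
  rw [intervalIntegral.integral_neg, hftc, hend] at h1
  simp only [sin_zero] at h1
  have := sin_sq_le_one (U (conePt b s))
  linarith

/-- Derivative of the scaling-multiplier flux, bounded above under a pointwise bound on `U`. -/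
lemma exists_hasDerivAt_scaling (h : ConeSolution U W T) {b C : ℝ} (hb : b ∈ Ioo 0 T)
    (hC : ∀ s ∈ Icc (0 : ℝ) 1, |U (conePt b s)| ≤ C) :
    ∃ D, HasDerivAt (coneInt (scDens U (-1))) D b ∧
      D ≤ scDens U 1 (conePt b 0) + b * (4 + 2 * C) := by
  refine ⟨_, hasDerivAt_coneInt h.isOpen h.wedge (h.contDiffOn_scDens _) (h.contDiffOn_scDens 1)
    (fun b _ => by simp [scDens, conePt]) hb, ?_⟩
  have hd := fun σ => (h.contDiffOn_scDens σ).continuousOn_fderiv_of_isOpen h.isOpen le_rfl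
  have hint := intervalIntegrable_comp_conePt h.wedge
    (((hd (-1)).clm_apply (continuousOn_const (c := ((1, 1) : ℝ × ℝ)))).add
      ((hd 1).clm_apply (continuousOn_const (c := ((1, -1) : ℝ × ℝ))))) hb
  have hle : ∫ s in (0 : ℝ)..1, b * (fderiv ℝ (scDens U (-1)) (conePt b s) (1, 1) +
      fderiv ℝ (scDens U 1) (conePt b s) (1, -1)) ≤ ∫ _ in (0 : ℝ)..1, b * (4 + 2 * C) := by
    refine intervalIntegral.integral_mono_on_of_le_Ioo zero_le_one hint (by simp) fun s hs => ?_
    rw [h.fderiv_scDens_add hb ⟨hs.1.le, hs.2⟩]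
    refine mul_le_mul_of_nonneg_left ?_ hb.1.le
    have h1 := hC s ⟨hs.1.le, hs.2.le⟩
    generalize U (conePt b s) = x at *
    have h2 := sin_sq_le_one x
    have h3 : 0 ≤ x * (anG x * (2 * sin x ^ 2) / (conePt b s).2 ^ 2) := by
      have : x * (anG x * (2 * sin x ^ 2) / (conePt b s).2 ^ 2) =
        x * anG x * (2 * sin x ^ 2 / (conePt b s).2 ^ 2) := by ring
      rw [this]
      exact mul_nonneg (mul_anG_nonneg x) (by positivity)
    have h4 : -(x * sin (2 * x)) ≤ C := by
      refine (neg_le_abs _).trans ?_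
      rw [abs_mul]
      exact (mul_le_of_le_one_right (abs_nonneg _) (abs_sin_le_one _)).trans h1
    linarith
  simp only [intervalIntegral.integral_const, sub_zero, one_smul] at hle
  linarith

/-- The integrand of the backward cone energy, times `r²`. -/
noncomputable def decayDens (U : ℝ × ℝ → ℝ) (p : ℝ × ℝ) : ℝ :=
  (1 - p.2 / p.1) * (p.2 ^ 2 * (dT U p - dR U p) ^ 2) + sin (U p) ^ 2 +
    2 * (anG (U p) ^ 2 / (2 * p.2 ^ 2))

lemma intervalIntegrable_decayDens (h : ConeSolution U W T) {b : ℝ} (hb : b ∈ Ioo 0 T) :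
    IntervalIntegrable (fun s => b * decayDens U (conePt b s)) volume 0 1 := by
  refine intervalIntegrable_comp_conePt h.wedge ?_ hb
  have h1 := h.contDiffOn_dT.continuousOn
  have h2 := h.contDiffOn_dR.continuousOn
  have h3 : ContDiffOn ℝ 1 U W := h.contDiffOn.of_le (by norm_num)
  have h4 := (contDiffOn_singularPotential h.isOpen h3 h.axis).continuousOn
  have h5 := h3.continuousOn
  have h6 : ContinuousOn (fun p : ℝ × ℝ => p.2 / p.1) W :=
    continuousOn_snd.div continuousOn_fst fun p hp => (h.time_pos p hp).ne'
  unfold decayDens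
  fun_prop

lemma intervalIntegrable_scDens (h : ConeSolution U W T) {b : ℝ} (hb : b ∈ Ioo 0 T) :
    IntervalIntegrable (fun s => b * scDens U (-1) (conePt b s)) volume 0 1 :=
  intervalIntegrable_comp_conePt h.wedge (h.contDiffOn_scDens _).continuousOn hb

lemma scaling_le (h : ConeSolution U W T) {b C : ℝ} (hb : b ∈ Ioo 0 T)
    (hC : ∀ s ∈ Icc (0 : ℝ) 1, |U (conePt b s)| ≤ C) :
    coneInt (scDens U (-1)) b ≤ 3 * b * coneInt (enDens U (-1)) b + b ^ 2 * C ^ 2 / 2 := by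
  have hle : coneInt (scDens U (-1)) b ≤ ∫ s in (0 : ℝ)..1,
      (3 * b * (b * enDens U (-1) (conePt b s)) + b ^ 2 * C ^ 2 / 2) := by
    refine intervalIntegral.integral_mono_on zero_le_one (h.intervalIntegrable_scDens hb)
      (((h.intervalIntegrable_enDens hb).const_mul _).add (by simp)) fun s hs => ?_
    have hU := sq_le_sq' (neg_le_of_abs_le (hC s hs)) (le_of_abs_le (hC s hs))
    have hb0 := hb.1
    suffices hp : scDens U (-1) (conePt b s) ≤
        3 * b * enDens U (-1) (conePt b s) + b * C ^ 2 / 2 by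
      have := mul_le_mul_of_nonneg_left hp hb0.le
      linarith
    unfold scDens enDens
    have e1 : (conePt b s).1 = b * (1 + s) := rfl
    have e2 : (conePt b s).2 = b * (1 - s) := rfl
    have hβ : 0 ≤ anG (U (conePt b s)) ^ 2 / (2 * (conePt b s).2 ^ 2) := by positivity
    generalize anG (U (conePt b s)) ^ 2 / (2 * (conePt b s).2 ^ 2) = β at *
    generalize dT U (conePt b s) = X at *
    generalize dR U (conePt b s) = Y at *
    rw [e1, e2]
    generalize U (conePt b s) = u at *
    have h1s : 0 ≤ 1 - s := by linarith [hs.2]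
    have hz : (1 - s) * ((b * (1 - s) * (X - Y)) * u) ≤
        (1 - s) * ((b * (1 - s) * (X - Y)) ^ 2 / 2 + C ^ 2 / 2) :=
      mul_le_mul_of_nonneg_left (by nlinarith [sq_nonneg ((b * (1 - s) * (X - Y)) - u)]) h1s
    have hz' := mul_le_mul_of_nonneg_left hz hb0.le
    have p1 : 0 ≤ b * sin u ^ 2 := by positivity
    have p2 : 0 ≤ b * β := by positivity
    have p3 : 0 ≤ b * (s * C ^ 2) := mul_nonneg hb0.le (mul_nonneg hs.1 (sq_nonneg _))
    have p4 : 0 ≤ b * ((1 - s) * (b * (1 - s) * (X - Y)) ^ 2) := by positivity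
    have p5 : 0 ≤ b * (s * (b * (1 - s) * (X - Y)) ^ 2) :=
      mul_nonneg hb0.le (mul_nonneg hs.1 (sq_nonneg _))
    nlinarith
  refine hle.trans_eq ?_
  rw [intervalIntegral.integral_add ((h.intervalIntegrable_enDens hb).const_mul _) (by simp),
    intervalIntegral.integral_const_mul]
  simp [coneInt]

lemma decay_le (h : ConeSolution U W T) {b C : ℝ} (hb : b ∈ Ioo 0 T)
    (hC : ∀ s ∈ Icc (0 : ℝ) 1, |U (conePt b s)| ≤ C) :
    coneInt (decayDens U) b ≤ 2 / b * coneInt (scDens U (-1)) b +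
      √b * (4 * coneInt (enDens U (-1)) b + C ^ 2 / 2) := by
  have hb0 := hb.1
  have hle : coneInt (decayDens U) b ≤ ∫ s in (0 : ℝ)..1,
      (2 / b * (b * scDens U (-1) (conePt b s)) + (4 * √b * (b * enDens U (-1) (conePt b s)) +
        √b * C ^ 2 / 2)) := by
    refine intervalIntegral.integral_mono_on zero_le_one (h.intervalIntegrable_decayDens hb)
      (((h.intervalIntegrable_scDens hb).const_mul _).add
        (((h.intervalIntegrable_enDens hb).const_mul _).add (by simp))) fun s hs => ?_
    have hU := sq_le_sq' (neg_le_of_abs_le (hC s hs)) (le_of_abs_le (hC s hs))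
    unfold scDens enDens decayDens
    have e1 : (conePt b s).1 = b * (1 + s) := rfl
    have e2 : (conePt b s).2 = b * (1 - s) := rfl
    have hβ : 0 ≤ anG (U (conePt b s)) ^ 2 / (2 * (conePt b s).2 ^ 2) := by positivity
    generalize anG (U (conePt b s)) ^ 2 / (2 * (conePt b s).2 ^ 2) = β at *
    generalize dT U (conePt b s) = X at *
    generalize dR U (conePt b s) = Y at *
    rw [e1, e2]
    generalize U (conePt b s) = u at *
    obtain ⟨c, hc, rfl⟩ : ∃ c, 0 < c ∧ c ^ 2 = b := ⟨√b, by positivity, sq_sqrt hb0.le⟩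
    rw [sqrt_sq hc.le]
    have h1s : 0 ≤ 1 - s := by linarith [hs.2]
    have hs1 : 0 < 1 + s := by linarith [hs.1]
    set Z := c ^ 2 * (1 - s) * (X - Y) with hZ
    have hw : 1 - c ^ 2 * (1 - s) / (c ^ 2 * (1 + s)) ≤ 2 * s := by
      have : 1 - c ^ 2 * (1 - s) / (c ^ 2 * (1 + s)) = 2 * s / (1 + s) := by
        field_simp; ring
      rw [this, div_le_iff₀ hs1]
      nlinarith [hs.1]
    have hw' := mul_le_mul_of_nonneg_left (mul_le_mul_of_nonneg_right hw (sq_nonneg Z)) hb0.le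
    have hcs : -(2 * c ^ 2 * (1 - s) * (u * Z)) ≤ c * (2 * c ^ 2 * Z ^ 2) + c * (C ^ 2 / 2) := by
      have : -(2 * c * (u * Z)) * (1 - s) ≤ 2 * c ^ 2 * Z ^ 2 + C ^ 2 / 2 := by
        have hk : -(2 * c * (u * Z)) ≤ 2 * c ^ 2 * Z ^ 2 + C ^ 2 / 2 := by
          nlinarith [sq_nonneg (2 * c * Z + u)]
        have hk0 : 0 ≤ 2 * c ^ 2 * Z ^ 2 + C ^ 2 / 2 := by positivity
        calc _ ≤ (2 * c ^ 2 * Z ^ 2 + C ^ 2 / 2) * (1 - s) := mul_le_mul_of_nonneg_right hk h1s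
          _ ≤ _ := mul_le_of_le_one_right hk0 (by linarith [hs.1])
      have := mul_le_mul_of_nonneg_left this hc.le
      linarith
    have q1 : 0 ≤ c ^ 2 * sin u ^ 2 := by positivity
    have q2 : 0 ≤ c ^ 2 * β := by positivity
    have q3 : 0 ≤ c * (c ^ 2 * sin u ^ 2) := by positivity
    have q4 : 0 ≤ c * (c ^ 2 * β) := by positivity
    have r1 : 2 / c ^ 2 * (c ^ 2 * ((c ^ 2 * (1 + s) + -1 * (c ^ 2 * (1 - s))) / 2 *
        ((c ^ 2 * (1 - s)) ^ 2 * (X + -1 * Y) ^ 2) +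
        (c ^ 2 * (1 + s) - -1 * (c ^ 2 * (1 - s))) * (sin u ^ 2 + β) +
        (c ^ 2 * (1 - s)) ^ 2 * u * (X + -1 * Y))) =
        2 * (c ^ 2 * s * Z ^ 2 + 2 * c ^ 2 * (sin u ^ 2 + β) + c ^ 2 * (1 - s) * (u * Z)) := by
      rw [hZ]; field_simp; ring
    rw [r1]
    have r2 : (c ^ 2 * (1 - s)) ^ 2 * (X - Y) ^ 2 = Z ^ 2 := by rw [hZ]; ring
    have r3 : 1 / 2 * (c ^ 2 * (1 - s)) ^ 2 * (X + -1 * Y) ^ 2 = Z ^ 2 / 2 := by rw [hZ]; ring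
    rw [r2, r3]
    linarith
  refine hle.trans_eq ?_
  rw [intervalIntegral.integral_add ((h.intervalIntegrable_scDens hb).const_mul _)
    (((h.intervalIntegrable_enDens hb).const_mul _).add (by simp)),
    intervalIntegral.integral_add ((h.intervalIntegrable_enDens hb).const_mul _) (by simp),
    intervalIntegral.integral_const_mul (2 / b), intervalIntegral.integral_const_mul (4 * √b),
    intervalIntegral.integral_const, sub_zero, one_smul]
  unfold coneInt
  ring

lemma scaling_sub_le (h : ConeSolution U W T) {b₁ b₂ C : ℝ} (hb₁ : 0 < b₁) (hb : b₁ ≤ b₂)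
    (hb₂ : b₂ < T) (hC : ∀ b ∈ Icc b₁ b₂, ∀ s ∈ Icc (0 : ℝ) 1, |U (conePt b s)| ≤ C) :
    coneInt (scDens U (-1)) b₂ - coneInt (scDens U (-1)) b₁ ≤
      4 * b₂ * (coneInt (enDens U (-1)) b₂ - coneInt (enDens U (-1)) b₁) +
        b₂ * (4 + 2 * C + C ^ 2 / 4) * (b₂ - b₁) := by
  have hsub : ∀ b ∈ Icc b₁ b₂, b ∈ Ioo 0 T := fun b hb => ⟨hb₁.trans_le hb.1, hb.2.trans_lt hb₂⟩
  have hd : ∀ b ∈ Icc b₁ b₂, ∃ D, HasDerivAt (fun b => 4 * b₂ * coneInt (enDens U (-1)) b +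
      b₂ * (4 + 2 * C + C ^ 2 / 4) * b - coneInt (scDens U (-1)) b) D b ∧ 0 ≤ D := by
    intro b hbI
    obtain ⟨D, hD, hDle⟩ := h.exists_hasDerivAt_scaling (hsub b hbI) (hC b hbI)
    refine ⟨_, (((h.hasDerivAt_energy (hsub b hbI)).const_mul (4 * b₂)).add
      ((hasDerivAt_id b).const_mul (b₂ * (4 + 2 * C + C ^ 2 / 4)))).sub hD, ?_⟩
    have hb0 : 0 < b := (hsub b hbI).1
    have hC0 : 0 ≤ C := (abs_nonneg _).trans (hC b hbI 0 ⟨le_rfl, zero_le_one⟩)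
    have hU := hC b hbI 0 ⟨le_rfl, zero_le_one⟩
    have e1 : (conePt b 0).1 = b := by simp [conePt]
    have e2 : (conePt b 0).2 = b := by simp [conePt]
    unfold enDens
    unfold scDens at hDle
    have hβ : 0 ≤ anG (U (conePt b 0)) ^ 2 / (2 * (conePt b 0).2 ^ 2) := by positivity
    generalize anG (U (conePt b 0)) ^ 2 / (2 * (conePt b 0).2 ^ 2) = β at *
    generalize dT U (conePt b 0) = X at *
    generalize dR U (conePt b 0) = Y at *
    rw [e1, e2] at hDle
    rw [e2]
    generalize U (conePt b 0) = u at *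
    set x := b * (X + Y) with hx
    have hux : u * x ≤ x ^ 2 + C ^ 2 / 4 := by
      have := sq_le_sq' (neg_le_of_abs_le hU) (le_of_abs_le hU)
      nlinarith [sq_nonneg (x - u / 2)]
    have hDle' : D ≤ b * (2 * x ^ 2 + (4 + 2 * C + C ^ 2 / 4)) := by
      refine hDle.trans ?_
      have := mul_le_mul_of_nonneg_left hux hb0.le
      have e : (b + 1 * b) / 2 * (b ^ 2 * (X + 1 * Y) ^ 2) + (b - 1 * b) * (sin u ^ 2 + β) +
        b ^ 2 * u * (X + 1 * Y) = b * x ^ 2 + b * (u * x) := by rw [hx]; ring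
      rw [e]
      linarith
    have hbb : b * (2 * x ^ 2 + (4 + 2 * C + C ^ 2 / 4)) ≤
        b₂ * (2 * x ^ 2 + (4 + 2 * C + C ^ 2 / 4)) :=
      mul_le_mul_of_nonneg_right hbI.2 (by positivity)
    have hb20 : 0 < b₂ := hb0.trans_le hbI.2
    have e : 4 * b₂ * (1 / 2 * b ^ 2 * (X + 1 * Y) ^ 2 + sin u ^ 2 + β) =
      b₂ * (2 * x ^ 2) + 4 * b₂ * (sin u ^ 2 + β) := by rw [hx]; ring
    have : 0 ≤ 4 * b₂ * (sin u ^ 2 + β) := by positivity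
    rw [e]
    linarith
  have hmono := monotoneOn_of_deriv_nonneg (convex_Icc b₁ b₂)
    (fun b hb => (hd b hb).choose_spec.1.continuousAt.continuousWithinAt)
    (fun b hb => (hd b (interior_subset hb)).choose_spec.1.differentiableAt.differentiableWithinAt)
    (fun b hb => by
      have := (hd b (interior_subset hb)).choose_spec
      rw [this.1.deriv]
      exact this.2)
  have := hmono ⟨le_rfl, hb⟩ ⟨hb, le_rfl⟩ hb
  simp only at this
  linarith

lemma decayDens_nonneg (h : ConeSolution U W T) {b s : ℝ} (hb : b ∈ Ioo 0 T)
    (hs : s ∈ Icc (0 : ℝ) 1) : 0 ≤ decayDens U (conePt b s) := by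
  have h1 : 0 ≤ 1 - (conePt b s).2 / (conePt b s).1 := by
    rw [sub_nonneg, div_le_one (h.time_pos _ (h.wedge b hb s hs))]
    exact mul_le_mul_of_nonneg_left (by linarith [hs.1]) hb.1.le
  unfold decayDens
  positivity

lemma tendsto_coneInt_decayDens (h : ConeSolution U W T) :
    Tendsto (coneInt (decayDens U)) (𝓝[>] 0) (𝓝 0) := by
  set E := coneInt (enDens U (-1)) with hE
  have hT := h.pos
  set T₀ := T / 2 with hT₀
  have hT₀pos : 0 < T₀ := by positivity
  have hT₀T : T₀ < T := by linarith
  have hmem : ∀ b ∈ Ioc 0 T₀, b ∈ Ioo 0 T := fun b hb => ⟨hb.1, hb.2.trans_lt hT₀T⟩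
  have hEmono := h.monotoneOn_energy
  have hEnn : ∀ b, 0 < b → 0 ≤ E b := fun b hb =>
    intervalIntegral.integral_nonneg zero_le_one fun s _ =>
      mul_nonneg hb.le (enDens_nonneg _ _ _)
  set K := E T₀ with hK
  have hK0 : 0 ≤ K := hEnn _ hT₀pos
  have hEK : ∀ b ∈ Ioc 0 T₀, E b ≤ K := fun b hb =>
    hEmono (hmem b hb) (hmem T₀ ⟨hT₀pos, le_rfl⟩) hb.2
  set C := √(2 * K + 1) with hC
  have hbound : ∀ b ∈ Ioc 0 T₀, ∀ s ∈ Icc (0 : ℝ) 1, |U (conePt b s)| ≤ C := by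
    intro b hb s hs
    refine abs_le_sqrt ((h.sq_le_energy (hmem b hb) hs).trans ?_)
    have := hEK b hb
    linarith
  set C' := 4 + 2 * C + C ^ 2 / 4 with hC'
  have hgmono : MonotoneOn (fun b => E (min b T₀)) (Ioi 0) := fun x hx y hy hxy =>
    hEmono (hmem _ ⟨lt_min hx hT₀pos, min_le_right _ _⟩)
      (hmem _ ⟨lt_min hy hT₀pos, min_le_right _ _⟩) (min_le_min_right _ hxy)
  have hbdd : BddBelow ((fun b => E (min b T₀)) '' Ioi 0) :=
    ⟨0, by rintro _ ⟨b, hb, rfl⟩; exact hEnn _ (lt_min hb hT₀pos)⟩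
  have hlim := hgmono.tendsto_nhdsGT hbdd
  set L := sInf ((fun b => E (min b T₀)) '' Ioi 0) with hL
  have hLle : ∀ b ∈ Ioc 0 T₀, L ≤ E b := fun b hb => by
    have := csInf_le hbdd (mem_image_of_mem (fun b => E (min b T₀)) (show b ∈ Ioi (0 : ℝ) from hb.1))
    simpa [min_eq_left hb.2] using this
  have hnear : Ioc 0 T₀ ∈ 𝓝[>] (0 : ℝ) := Ioc_mem_nhdsGT hT₀pos
  have hElim : Tendsto E (𝓝[>] 0) (𝓝 L) :=
    hlim.congr' (by filter_upwards [hnear] with b hb; simp [min_eq_left hb.2])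
  have hscale : ∀ b ∈ Ioc 0 T₀, coneInt (scDens U (-1)) b ≤ 4 * b * (E b - L) + b * C' * b := by
    intro b hb
    have hev : ∀ᶠ x in 𝓝[>] (0 : ℝ), coneInt (scDens U (-1)) b ≤
        3 * x * K + x ^ 2 * C ^ 2 / 2 + (4 * b * (E b - L) + b * C' * (b - x)) := by
      filter_upwards [Ioc_mem_nhdsGT hb.1] with x hx
      have hx' : x ∈ Ioc 0 T₀ := ⟨hx.1, hx.2.trans hb.2⟩
      have h1 := h.scaling_sub_le hx.1 hx.2 (hmem b hb).2
        (fun y hy => hbound y ⟨hx.1.trans_le hy.1, hy.2.trans hb.2⟩)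
      have h2 := h.scaling_le (hmem x hx') (hbound x hx')
      rw [← hE] at h1 h2
      rw [← hC'] at h1
      have h3 : 3 * x * E x ≤ 3 * x * K :=
        mul_le_mul_of_nonneg_left (hEK x hx') (by linarith [hx.1])
      have h4 : 4 * b * (E b - E x) ≤ 4 * b * (E b - L) :=
        mul_le_mul_of_nonneg_left (by linarith [hLle x hx']) (by linarith [hb.1])
      linarith
    have hc : Continuous fun x : ℝ =>
        3 * x * K + x ^ 2 * C ^ 2 / 2 + (4 * b * (E b - L) + b * C' * (b - x)) := by fun_prop
    have := ge_of_tendsto ((hc.tendsto 0).mono_left nhdsWithin_le_nhds) hev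
    simpa using this
  have hupper : Tendsto (fun b => 8 * (E b - L) + 2 * C' * b + √b * (4 * K + C ^ 2 / 2))
      (𝓝[>] 0) (𝓝 0) := by
    have hc : Continuous fun b : ℝ => 2 * C' * b + √b * (4 * K + C ^ 2 / 2) := by fun_prop
    have h1 := (hc.tendsto 0).mono_left (nhdsWithin_le_nhds (s := Ioi 0))
    have h2 := ((hElim.sub_const L).const_mul 8).add h1
    simpa [add_assoc] using h2
  refine tendsto_of_tendsto_of_tendsto_of_le_of_le' tendsto_const_nhds hupper ?_ ?_
  · filter_upwards [hnear] with b hb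
    exact intervalIntegral.integral_nonneg zero_le_one fun s hs =>
      mul_nonneg hb.1.le (h.decayDens_nonneg (hmem b hb) hs)
  · filter_upwards [hnear] with b hb
    have hb0 := hb.1
    refine (h.decay_le (hmem b hb) (hbound b hb)).trans ?_
    rw [← hE]
    have h1 : 2 / b * coneInt (scDens U (-1)) b ≤ 2 / b * (4 * b * (E b - L) + b * C' * b) :=
      mul_le_mul_of_nonneg_left (hscale b hb) (by positivity)
    have h2 : 2 / b * (4 * b * (E b - L) + b * C' * b) = 8 * (E b - L) + 2 * C' * b := by
      field_simp; ring
    have h3 : √b * (4 * E b + C ^ 2 / 2) ≤ √b * (4 * K + C ^ 2 / 2) :=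
      mul_le_mul_of_nonneg_left (by linarith [hEK b hb]) (sqrt_nonneg _)
    linarith

end ConeSolution

lemma deriv_left_eq_dT {f : ℝ × ℝ → ℝ} {t r : ℝ} (hf : DifferentiableAt ℝ f (t, r)) :
    deriv (fun s => f (s, r)) t = dT f (t, r) :=
  (hf.hasFDerivAt.comp_hasDerivAt t ((hasDerivAt_id t).prodMk (hasDerivAt_const t r))).deriv

lemma deriv_right_eq_dR {f : ℝ × ℝ → ℝ} {t r : ℝ} (hf : DifferentiableAt ℝ f (t, r)) :
    deriv (fun s => f (t, s)) r = dR f (t, r) :=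
  (hf.hasFDerivAt.comp_hasDerivAt r ((hasDerivAt_const r t).prodMk (hasDerivAt_id r))).deriv

section Identification

variable {u : ℝ → ℝ → ℝ} {V : Set (ℝ × ℝ)}

lemma ut_eq_dT (hV : IsOpen V) (hu : ContDiffOn ℝ 2 (fun p : ℝ × ℝ => u p.1 p.2) V) {t r : ℝ}
    (h : (t, r) ∈ V) : ut u t r = dT (fun p : ℝ × ℝ => u p.1 p.2) (t, r) :=
  deriv_left_eq_dT ((hu.contDiffAt (hV.mem_nhds h)).differentiableAt (by norm_num))

lemma ur_eq_dR (hV : IsOpen V) (hu : ContDiffOn ℝ 2 (fun p : ℝ × ℝ => u p.1 p.2) V) {t r : ℝ}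
    (h : (t, r) ∈ V) : ur u t r = dR (fun p : ℝ × ℝ => u p.1 p.2) (t, r) :=
  deriv_right_eq_dR ((hu.contDiffAt (hV.mem_nhds h)).differentiableAt (by norm_num))

lemma utt_eq_dT_dT (hV : IsOpen V) (hu : ContDiffOn ℝ 2 (fun p : ℝ × ℝ => u p.1 p.2) V) {t r : ℝ}
    (h : (t, r) ∈ V) : utt u t r = dT (dT (fun p : ℝ × ℝ => u p.1 p.2)) (t, r) := by
  have hd := ((contDiffOn_dT_of_isOpen hV hu).contDiffAt (hV.mem_nhds h)).differentiableAt
    (by norm_num)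
  have hc : Continuous fun s : ℝ => (s, r) := by fun_prop
  rw [← deriv_left_eq_dT hd]
  refine EventuallyEq.deriv_eq ?_
  filter_upwards [(hV.preimage hc).mem_nhds h] with s hs
  exact ut_eq_dT hV hu hs

lemma urr_eq_dR_dR (hV : IsOpen V) (hu : ContDiffOn ℝ 2 (fun p : ℝ × ℝ => u p.1 p.2) V) {t r : ℝ}
    (h : (t, r) ∈ V) : urr u t r = dR (dR (fun p : ℝ × ℝ => u p.1 p.2)) (t, r) := by
  have hd := ((contDiffOn_dR_of_isOpen hV hu).contDiffAt (hV.mem_nhds h)).differentiableAt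
    (by norm_num)
  have hc : Continuous fun s : ℝ => (t, s) := by fun_prop
  rw [← deriv_right_eq_dR hd]
  refine EventuallyEq.deriv_eq ?_
  filter_upwards [(hV.preimage hc).mem_nhds h] with s hs
  exact ur_eq_dR hV hu hs

lemma ANeq.dT_dR_eq (hV : IsOpen V) (hu : ContDiffOn ℝ 2 (fun p : ℝ × ℝ => u p.1 p.2) V) {t r : ℝ}
    (h : (t, r) ∈ V) (he : ANeq u t r) :
    dT (dT fun p : ℝ × ℝ => u p.1 p.2) (t, r) - dR (dR fun p : ℝ × ℝ => u p.1 p.2) (t, r) -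
      2 / r * dR (fun p : ℝ × ℝ => u p.1 p.2) (t, r) + sin (2 * u t r) / r ^ 2 +
      anG (u t r) * (2 * sin (u t r) ^ 2) / r ^ 4 = 0 := by
  rw [ANeq, utt_eq_dT_dT hV hu h, urr_eq_dR_dR hV hu h, ur_eq_dR hV hu h] at he
  have hcos : 1 - cos (2 * u t r) = 2 * sin (u t r) ^ 2 := by
    rw [cos_two_mul]; linarith [sin_sq_add_cos_sq (u t r)]
  rwa [hcos] at he

/-- The singular coefficient of the equation forces `sin u = 0` on the axis. -/
lemma sin_eq_zero_of_axis (hV : IsOpen V) (hu : ContDiffOn ℝ 2 (fun p : ℝ × ℝ => u p.1 p.2) V)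
    {t : ℝ} (h : (t, 0) ∈ V) (he : ∀ᶠ r in 𝓝[>] (0 : ℝ), ANeq u t r) : sin (u t 0) = 0 := by
  set U : ℝ × ℝ → ℝ := fun p => u p.1 p.2 with hU
  have c1 := contDiffOn_dT_of_isOpen hV hu
  have c2 := contDiffOn_dR_of_isOpen hV hu
  have hline : ContinuousAt (fun r : ℝ => (t, r)) 0 := by fun_prop
  have c3 : ContinuousAt (fun r => dT (dT U) (t, r)) 0 :=
    ((((c1.continuousOn_fderiv_of_isOpen hV le_rfl).clm_apply continuousOn_const).continuousAt
      (hV.mem_nhds h)).comp hline :)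
  have c4 : ContinuousAt (fun r => dR (dR U) (t, r)) 0 :=
    ((((c2.continuousOn_fderiv_of_isOpen hV le_rfl).clm_apply continuousOn_const).continuousAt
      (hV.mem_nhds h)).comp hline :)
  have c5 : ContinuousAt (fun r => dR U (t, r)) 0 :=
    ((c2.continuousOn.continuousAt (hV.mem_nhds h)).comp hline :)
  have c6 : ContinuousAt (fun r => u t r) 0 :=
    ((hu.continuousOn.continuousAt (hV.mem_nhds h)).comp hline :)
  have c7 : ContinuousAt (fun r => anG (u t r)) 0 :=
    ((contDiff_anG.continuous.continuousAt).comp c6 :)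
  have hc : ContinuousAt (fun r => r ^ 4 * (dT (dT U) (t, r) - dR (dR U) (t, r)) -
      2 * r ^ 3 * dR U (t, r) + r ^ 2 * sin (2 * u t r) + anG (u t r) * (2 * sin (u t r) ^ 2)) 0 := by
    fun_prop
  have hz : ∀ᶠ r in 𝓝[>] (0 : ℝ), r ^ 4 * (dT (dT U) (t, r) - dR (dR U) (t, r)) -
      2 * r ^ 3 * dR U (t, r) + r ^ 2 * sin (2 * u t r) +
        anG (u t r) * (2 * sin (u t r) ^ 2) = 0 := by
    filter_upwards [he, nhdsWithin_le_nhds (hline.preimage_mem_nhds (hV.mem_nhds h)),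
      self_mem_nhdsWithin] with r hr hrV hr0
    have hr0' : r ≠ 0 := ne_of_gt hr0
    have := hr.dT_dR_eq hV hu hrV
    rw [← hU] at this
    field_simp at this
    linarith
  have hlim := (hc.tendsto.mono_left nhdsWithin_le_nhds).congr' hz
  have := tendsto_nhds_unique hlim tendsto_const_nhds
  simp only [ne_eq, OfNat.ofNat_ne_zero, not_false_eq_true, zero_pow, zero_mul, mul_zero, sub_zero,
    zero_add, mul_eq_zero, false_or, pow_eq_zero_iff] at this
  rcases this with h0 | h0
  · rw [eq_zero_of_anG_eq_zero h0, sin_zero]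
  · exact h0

/-- Finiteness of the energy forces `u = 0` at the axis. -/
lemma eq_zero_of_integrableOn_eDens {t : ℝ} (ht : 0 < t) (hu : ContinuousAt (fun r => u t r) 0)
    (hint : IntegrableOn (fun r => eDens u t r * r ^ 2) (Ioc 0 t)) : u t 0 = 0 := by
  by_contra hne
  have hG : 0 < anG (u t 0) ^ 2 := by
    have : anG (u t 0) ≠ 0 := fun h => hne (eq_zero_of_anG_eq_zero h)
    positivity
  have hc : ContinuousAt (fun r => anG (u t r) ^ 2) 0 :=
    ((contDiff_anG.continuous.continuousAt).comp hu).pow 2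
  set c := anG (u t 0) ^ 2 / 2 with hcdef
  have hcpos : 0 < c := by positivity
  obtain ⟨δ, hδ, hball⟩ := Metric.eventually_nhds_iff_ball.1
    (hc.eventually_const_lt (show c < anG (u t 0) ^ 2 by linarith))
  set d := min (δ / 2) (min t 1) with hd
  have hd0 : 0 < d := by positivity
  have hdt : d ≤ t := (min_le_right _ _).trans (min_le_left _ _)
  have hd1 : d ≤ 1 := (min_le_right _ _).trans (min_le_right _ _)
  have hdδ : d < δ := (min_le_left _ _).trans_lt (by linarith)
  have hint' : IntegrableOn (fun r => eDens u t r * r ^ 2) (Ioc 0 d) :=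
    hint.mono_set (Ioc_subset_Ioc_right hdt)
  have hinv : IntegrableOn (fun r : ℝ => r⁻¹) (Ioc 0 d) := by
    refine (hint'.const_mul (2 / c)).mono' measurable_inv.aestronglyMeasurable ?_
    filter_upwards [ae_restrict_mem measurableSet_Ioc] with r hr
    have hr0 : 0 < r := hr.1
    have hr1 : r ≤ 1 := hr.2.trans hd1
    have hcr : c < anG (u t r) ^ 2 := hball r (by
      rw [Metric.mem_ball, dist_zero_right, norm_eq_abs, abs_of_pos hr0]; exact hr.2.trans_lt hdδ)
    rw [norm_eq_abs, abs_of_pos (by positivity)]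
    have h1 : c / (2 * r ^ 2) ≤ eDens u t r * r ^ 2 := by
      have e : eDens u t r * r ^ 2 = (1 / 2 * (ut u t r ^ 2 + ur u t r ^ 2) +
          sin (u t r) ^ 2 / r ^ 2) * r ^ 2 + anG (u t r) ^ 2 / (2 * r ^ 2) := by
        unfold eDens anG; field_simp
      rw [e]
      have : 0 ≤ (1 / 2 * (ut u t r ^ 2 + ur u t r ^ 2) + sin (u t r) ^ 2 / r ^ 2) * r ^ 2 := by
        positivity
      have : c / (2 * r ^ 2) ≤ anG (u t r) ^ 2 / (2 * r ^ 2) := by gcongr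
      linarith
    calc r⁻¹ ≤ r⁻¹ * r⁻¹ := le_mul_of_one_le_left (by positivity) ((one_le_inv₀ hr0).2 hr1)
      _ = 2 / c * (c / (2 * r ^ 2)) := by field_simp
      _ ≤ _ := by gcongr
  have := (intervalIntegrable_iff_integrableOn_Ioc_of_le hd0.le).2 hinv
  rw [intervalIntegrable_inv_iff] at this
  rcases this with h | h
  · exact hd0.ne h
  · exact h left_mem_uIcc

end Identification

/-- A continuous function on a preconnected set with values in the zeros of `sin` that vanishes
somewhere vanishes identically. -/
lemma eqOn_zero_of_sin_eq_zero {f : ℝ → ℝ} {S : Set ℝ} (hS : IsPreconnected S)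
    (hf : ContinuousOn f S) (hsin : ∀ t ∈ S, sin (f t) = 0) {a : ℝ} (ha : a ∈ S) (hfa : f a = 0)
    {t : ℝ} (ht : t ∈ S) : f t = 0 := by
  have himg := (hS.image f hf).ordConnected
  have h0 : (0 : ℝ) ∈ f '' S := ⟨a, ha, hfa⟩
  by_contra hne
  obtain ⟨n, hn⟩ := sin_eq_zero_iff.1 (hsin t ht)
  have hpi := pi_pos
  have hn0 : n ≠ 0 := by
    rintro rfl
    exact hne (by simpa using hn.symm)
  rcases lt_or_gt_of_ne hn0 with hlt | hgt
  · have : (n : ℝ) ≤ -1 := by exact_mod_cast Int.le_sub_one_of_lt hlt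
    obtain ⟨x, hx, hfx⟩ := himg.out ⟨t, ht, rfl⟩ h0
      (show -(π / 2) ∈ Icc (f t) 0 from ⟨by nlinarith, by linarith⟩)
    have := hsin x hx
    rw [hfx, sin_neg, sin_pi_div_two] at this
    norm_num at this
  · have : (1 : ℝ) ≤ n := by exact_mod_cast hgt
    obtain ⟨x, hx, hfx⟩ := himg.out h0 ⟨t, ht, rfl⟩
      (show π / 2 ∈ Icc 0 (f t) from ⟨by linarith, by nlinarith⟩)
    have := hsin x hx
    rw [hfx, sin_pi_div_two] at this
    norm_num at this

lemma conePt_mem_Dom {T b s : ℝ} (hb : b ∈ Ioo 0 T) (hs : s ∈ Icc (0 : ℝ) 1) :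
    conePt b s ∈ Dom T := by
  obtain ⟨hb0, hbT⟩ := hb
  obtain ⟨hs0, hs1⟩ := hs
  refine ⟨?_, ?_, ?_, le_min ?_ ?_⟩ <;> simp only [conePt] <;> nlinarith

lemma axis_mem_Dom {T t : ℝ} (ht : t ∈ Ioo 0 (2 * T)) : (t, (0 : ℝ)) ∈ Dom T :=
  ⟨ht.1, ht.2.le, le_rfl, le_min (by simpa using ht.2.le) ht.1.le⟩

lemma BackwardFramework.axis_eq_zero {u : ℝ → ℝ → ℝ} {T : ℝ} (h : BackwardFramework u T) {t : ℝ}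
    (ht : t ∈ Ioo 0 (2 * T)) : u t 0 = 0 := by
  obtain ⟨hT, ⟨V, hV, hDV, hu⟩, heq, hint⟩ := h
  have hu2 : ContDiffOn ℝ 2 (fun p : ℝ × ℝ => u p.1 p.2) V :=
    contDiffOn_infty.1 hu 2
  have hTm : T ∈ Ioo 0 (2 * T) := ⟨hT, by linarith⟩
  have hcont : ContinuousOn (fun t => u t 0) (Ioo 0 (2 * T)) :=
    (hu2.continuousOn.comp (f := fun t : ℝ => (t, (0 : ℝ))) (by fun_prop)
      fun t ht => hDV (axis_mem_Dom ht) :)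
  refine eqOn_zero_of_sin_eq_zero isPreconnected_Ioo hcont (fun t ht => ?_) hTm ?_ ht
  · refine sin_eq_zero_of_axis hV hu2 (hDV (axis_mem_Dom ht)) ?_
    have hm : 0 < min (2 * T - t) t := lt_min (by linarith [ht.2]) ht.1
    filter_upwards [Ioc_mem_nhdsGT hm] with r hr
    exact heq (t, r) ⟨ht.1, ht.2.le, hr.1.le, hr.2⟩ hr.1
  · refine eq_zero_of_integrableOn_eDens hT ?_ hint
    have hline : ContinuousAt (fun r : ℝ => (T, r)) 0 := by fun_prop
    exact ((hu2.continuousOn.continuousAt (hV.mem_nhds (hDV (axis_mem_Dom hTm)))).comp hline :)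

lemma BackwardFramework.exists_coneSolution {u : ℝ → ℝ → ℝ} {T : ℝ} (h : BackwardFramework u T) :
    ∃ W, ConeSolution (fun p : ℝ × ℝ => u p.1 p.2) W T := by
  have hax := fun t => h.axis_eq_zero (t := t)
  obtain ⟨hT, ⟨V, hV, hDV, hu⟩, heq, -⟩ := h
  have hu2 : ContDiffOn ℝ 2 (fun p : ℝ × ℝ => u p.1 p.2) V :=
    contDiffOn_infty.1 hu 2
  refine ⟨V ∩ {p | 0 < p.1 ∧ (p.2 ≠ 0 ∨ p.1 < 2 * T)}, hT, ?_, fun p hp => hp.2.1,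
    fun b hb s hs => ⟨hDV (conePt_mem_Dom hb hs), (conePt_mem_Dom hb hs).1, ?_⟩,
    hu2.mono inter_subset_left, ?_, ?_⟩
  · refine hV.inter ((isOpen_lt continuous_const continuous_fst).inter (IsOpen.union ?_
      (isOpen_lt continuous_fst continuous_const)))
    exact isOpen_ne.preimage continuous_snd
  · right
    simp only [conePt]
    nlinarith [hb.1, hb.2, hs.1, hs.2]
  · rintro ⟨t, r⟩ ⟨-, ht, h0⟩ (rfl : r = 0)
    exact hax t ⟨ht, h0.resolve_left (by simp)⟩
  · rintro b hb s hs p rfl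
    have hD := conePt_mem_Dom hb (Ico_subset_Icc_self hs)
    exact (heq _ hD (mul_pos hb.1 (by linarith [hs.2]))).dT_dR_eq hV hu2 (hDV hD)

lemma BackwardFramework.integral_eq_coneInt {u : ℝ → ℝ → ℝ} {Tbar : ℝ}
    (h : BackwardFramework u Tbar) {T : ℝ} (hT : T ∈ Ioo 0 Tbar) :
    ∫ r in (0 : ℝ)..T,
        ((1 - r / (2 * T - r)) * uminus u (2 * T - r) r ^ 2 +
          sin (u (2 * T - r) r) ^ 2 / r ^ 2 +
          (u (2 * T - r) r - sin (u (2 * T - r) r) * cos (u (2 * T - r) r)) ^ 2 / r ^ 4) * r ^ 2 =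
      coneInt (ConeSolution.decayDens fun p : ℝ × ℝ => u p.1 p.2) T := by
  obtain ⟨-, ⟨V, hV, hDV, hu⟩, -, -⟩ := h
  have hu2 : ContDiffOn ℝ 2 (fun p : ℝ × ℝ => u p.1 p.2) V :=
    contDiffOn_infty.1 hu 2
  have hT0 : T ≠ 0 := hT.1.ne'
  have hsub := intervalIntegral.integral_comp_sub_mul (a := 0) (b := 1) (fun r : ℝ =>
    ((1 - r / (2 * T - r)) * uminus u (2 * T - r) r ^ 2 + sin (u (2 * T - r) r) ^ 2 / r ^ 2 +
      (u (2 * T - r) r - sin (u (2 * T - r) r) * cos (u (2 * T - r) r)) ^ 2 / r ^ 4) * r ^ 2) hT0 T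
  rw [mul_one, mul_zero, sub_self, sub_zero, smul_eq_mul, eq_inv_mul_iff_mul_eq₀ hT0] at hsub
  rw [← hsub, coneInt, ← intervalIntegral.integral_const_mul]
  refine intervalIntegral.integral_congr_Ioo_of_le zero_le_one fun s hs => ?_
  have hmem := hDV (conePt_mem_Dom hT (Ioo_subset_Icc_self hs))
  have e1 : 2 * T - (T - T * s) = T * (1 + s) := by ring
  have e2 : T - T * s = T * (1 - s) := by ring
  have hr : T * (1 - s) ≠ 0 := mul_ne_zero hT0 (by linarith [hs.2])
  simp only [e1]
  rw [e2, uminus, ut_eq_dT hV hu2 hmem, ur_eq_dR hV hu2 hmem]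
  simp only [ConeSolution.decayDens, conePt, anG]
  have h1 : 1 + s ≠ 0 := by linarith [hs.1]
  have h2 : 1 - s ≠ 0 := by linarith [hs.2]
  field_simp

/-- Energy decay along backward light cones: as `T → 0⁺`,
`∫_0^T [(1 - r/(2T - r)) u₋(2T - r, r)² + sin²u/r² + (u - sin u cos u)²/r⁴] r² dr → 0`,
where all quantities are evaluated on the cone `t = 2T - r`. -/
theorem cone_energy_decay (u : ℝ → ℝ → ℝ) (Tbar : ℝ)
    (h : BackwardFramework u Tbar) :
    Tendsto (fun T : ℝ =>
      ∫ r in (0 : ℝ)..T,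
        ((1 - r / (2 * T - r)) * uminus u (2 * T - r) r ^ 2 +
          Real.sin (u (2 * T - r) r) ^ 2 / r ^ 2 +
          (u (2 * T - r) r -
            Real.sin (u (2 * T - r) r) * Real.cos (u (2 * T - r) r)) ^ 2 / r ^ 4) *
          r ^ 2) (𝓝[>] (0 : ℝ)) (𝓝 0) := by
  obtain ⟨W, hW⟩ := h.exists_coneSolution
  refine hW.tendsto_coneInt_decayDens.congr' ?_
  filter_upwards [Ioo_mem_nhdsGT h.1] with T hT
  exact (h.integral_eq_coneInt hT).symm
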